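/- arXiv:1507.07598 — 4 statements merged into one kernel-verified Lean document; each statement's English description precedes it below -/
import Mathlib

section
/- Let S be a closed subset of ℝ^p and let f : ℝ^p → ℝ achieve a local minimum over S at the point x ∈ S. Let φ_S : ℝ^p → ℝ be a function that vanishes on S and satisfies φ_S(y) ≥ c·dist(y,S) for all y ∈ ℝ^p and some constant c > 0, where dist(y,S) = inf_{z∈S} ‖y−z‖ is the Euclidean distance to S. If f is Lipschitz with constant L on some neighborhood of x, then for every ρ ≥ L/c the function F_ρ(y) = f(y) + ρ·φ_S(y) achieves an unconstrained local minimum at x. -/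
/-- Clarke's exact penalty theorem: if `f` achieves a local minimum over the closed
set `S` at `x`, `φ` vanishes on `S` and dominates `c · dist(·,S)`, and `f` is
Lipschitz with constant `L` near `x`, then for every `ρ ≥ L/c` the penalized
function `f + ρ·φ` achieves an unconstrained local minimum at `x`. -/
theorem stmt_0 (p : ℕ) (S : Set (EuclideanSpace ℝ (Fin p))) (hS : IsClosed S)
    (f φ : EuclideanSpace ℝ (Fin p) → ℝ)
    (x : EuclideanSpace ℝ (Fin p)) (hxS : x ∈ S)
    (hmin : IsLocalMinOn f S x)
    (hφ0 : ∀ y ∈ S, φ y = 0)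
    (c : ℝ) (hc : 0 < c)
    (hφ : ∀ y, c * Metric.infDist y S ≤ φ y)
    (L : ℝ)
    (hLip : ∃ U ∈ nhds x, ∀ u ∈ U, ∀ v ∈ U, |f u - f v| ≤ L * ‖u - v‖)
    (ρ : ℝ) (hρ : L / c ≤ ρ) :
    IsLocalMin (fun y => f y + ρ * φ y) x := by
  obtain ⟨U, hU, hLip⟩ := hLip
  have hxU : x ∈ U := mem_of_mem_nhds hU
  have hφx : φ x = 0 := hφ0 x hxS
  rcases lt_or_ge L 0 with hL | hL
  · -- a negative constant forces `U = {x}`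
    filter_upwards [hU] with y hy
    have h := (abs_nonneg _).trans (hLip y hy x hxU)
    have hyx : y = x := by
      rw [← sub_eq_zero, ← norm_le_zero_iff]
      by_contra! hpos
      exact absurd h (not_le.mpr (mul_neg_of_neg_of_pos hL hpos))
    rw [hyx]
  · obtain ⟨r, hr, hball⟩ := Metric.mem_nhds_iff.mp
      (Filter.inter_mem hU (mem_nhdsWithin_iff_eventually.mp hmin))
    filter_upwards [Metric.ball_mem_nhds x (half_pos hr)] with y hy
    obtain ⟨z, hzS, hz⟩ := hS.exists_infDist_eq_dist ⟨x, hxS⟩ y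
    rw [Metric.mem_ball] at hy
    have hyz : dist y z ≤ dist y x := hz ▸ Metric.infDist_le_dist_of_mem hxS
    have hzr : z ∈ Metric.ball x r := by
      rw [Metric.mem_ball]
      linarith [dist_triangle_left z x y]
    have hyr : y ∈ Metric.ball x r := Metric.ball_subset_ball (by linarith) hy
    have hxz : f x ≤ f z := (hball hzr).2 hzS
    have hzy : f z - f y ≤ L * dist y z := by
      rw [dist_comm, dist_eq_norm]
      exact (le_abs_self _).trans (hLip z (hball hzr).1 y (hball hyr).1)
    have hρ0 : 0 ≤ ρ := (div_nonneg hL hc.le).trans hρ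
    have hpen : L * dist y z ≤ ρ * φ y := calc
      L * dist y z ≤ ρ * c * dist y z :=
        mul_le_mul_of_nonneg_right ((div_le_iff₀ hc).mp hρ) dist_nonneg
      _ = ρ * (c * Metric.infDist y S) := by rw [hz, mul_assoc]
      _ ≤ ρ * φ y := mul_le_mul_of_nonneg_left (hφ y) hρ0
    simp only [hφx, mul_zero, add_zero]
    linarith
end

section
/- Let h be a thrice differentiable convex function on an interval [0, T) that is self-concordant with constant c > 0 and satisfies h''(t) > 0 on [0, T). Then for every t ∈ [0, T) with c·t·√(h''(0)) < 1, the majorization h(t) ≤ h(0) + h'(0)·t − (1/c)·√(h''(0))·t − (1/c²)·ln(1 − c·t·√(h''(0))) holds, with equality at t = 0. -/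
open Set

/-- Comparison of two functions on a closed interval through their derivatives. -/
theorem le_on_Icc_of_hasDerivWithinAt_le {F G F' G' : ℝ → ℝ} {a b : ℝ}
    (hF : ∀ s ∈ Icc a b, HasDerivWithinAt F (F' s) (Icc a b) s)
    (hG : ∀ s ∈ Icc a b, HasDerivWithinAt G (G' s) (Icc a b) s)
    (hle : ∀ s ∈ Icc a b, F' s ≤ G' s) (ha : F a ≤ G a) :
    ∀ s ∈ Icc a b, F s ≤ G s := by
  have hmono : MonotoneOn (fun s => G s - F s) (Icc a b) := by
    refine monotoneOn_of_hasDerivWithinAt_nonneg (f' := fun s => G' s - F' s) (convex_Icc a b)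
      (fun s hs => ((hG s hs).sub (hF s hs)).continuousWithinAt) (fun s hs => ?_) (fun s hs => ?_)
    · exact ((hG s (interior_subset hs)).sub (hF s (interior_subset hs))).mono interior_subset
    · exact sub_nonneg.2 (hle s (interior_subset hs))
  intro s hs
  have := hmono (left_mem_Icc.2 (hs.1.trans hs.2)) hs hs.1
  simp only at this
  linarith

/-- The second derivative `g` of a self-concordant function is bounded by
`g 0 / (1 - c s √(g 0)) ^ 2`. -/
theorem le_sq_div_of_selfConcordant {g g' : ℝ → ℝ} {c t : ℝ} (hc : 0 < c)
    (hg : ∀ s ∈ Icc 0 t, HasDerivWithinAt g (g' s) (Icc 0 t) s)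
    (hpos : ∀ s ∈ Icc 0 t, 0 < g s)
    (hsc : ∀ s ∈ Icc 0 t, |g' s| ≤ 2 * c * g s ^ ((3 : ℝ) / 2))
    (hlt : c * t * √(g 0) < 1) :
    ∀ s ∈ Icc 0 t, g s ≤ (√(g 0) / (1 - c * s * √(g 0))) ^ 2 := by
  have hinv : ∀ s ∈ Icc 0 t, (√(g 0))⁻¹ - c * s ≤ (√(g s))⁻¹ := by
    refine le_on_Icc_of_hasDerivWithinAt_le (F' := fun _ => -c)
      (G' := fun s => -(g' s / (2 * √(g s))) / √(g s) ^ 2) (fun s _ => ?_) (fun s hs => ?_)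
      (fun s hs => ?_) (by simp)
    · simpa using ((hasDerivAt_id s).const_mul c).const_sub (√(g 0))⁻¹ |>.hasDerivWithinAt
    · exact ((hg s hs).sqrt (hpos s hs).ne').inv (Real.sqrt_pos.2 (hpos s hs)).ne'
    · have hr := Real.sqrt_pos.2 (hpos s hs)
      have hpow : g s ^ ((3 : ℝ) / 2) = √(g s) ^ 3 := by
        rw [Real.sqrt_eq_rpow, ← Real.rpow_natCast, ← Real.rpow_mul (hpos s hs).le]
        norm_num
      have hb := (le_abs_self _).trans (hsc s hs)
      rw [hpow] at hb
      rw [neg_div, neg_le_neg_iff, div_div, div_le_iff₀ (by positivity)]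
      linarith
  intro s hs
  have ha := Real.sqrt_pos.2 (hpos 0 (left_mem_Icc.2 (hs.1.trans hs.2)))
  have hr := Real.sqrt_pos.2 (hpos s hs)
  have hlt' : 0 < 1 - c * s * √(g 0) := by
    have : c * s * √(g 0) ≤ c * t * √(g 0) := by gcongr; exact hs.2
    linarith
  have hmul := mul_le_mul_of_nonneg_right (hinv s hs) (mul_pos ha hr).le
  have hle : √(g s) ≤ √(g 0) / (1 - c * s * √(g 0)) := by
    rw [le_div_iff₀ hlt']
    field_simp at hmul
    linarith
  calc g s = √(g s) ^ 2 := (Real.sq_sqrt (hpos s hs).le).symm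
    _ ≤ _ := by gcongr


/-- The self-concordant majorization: for a thrice differentiable convex function
`h` on `[0,T)` that is self-concordant with constant `c > 0` and has `h'' > 0`,
for every `t ∈ [0,T)` with `c·t·√(h''(0)) < 1`,
`h(t) ≤ h(0) + h'(0)·t - (1/c)·√(h''(0))·t - (1/c²)·ln(1 - c·t·√(h''(0)))`,
with equality at `t = 0`. -/
theorem stmt_7 (T c : ℝ) (hT : 0 < T) (hc : 0 < c)
    (h h' h'' h''' : ℝ → ℝ)
    (hd1 : ∀ t ∈ Set.Ico (0 : ℝ) T, HasDerivWithinAt h (h' t) (Set.Ico (0 : ℝ) T) t)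
    (hd2 : ∀ t ∈ Set.Ico (0 : ℝ) T, HasDerivWithinAt h' (h'' t) (Set.Ico (0 : ℝ) T) t)
    (hd3 : ∀ t ∈ Set.Ico (0 : ℝ) T, HasDerivWithinAt h'' (h''' t) (Set.Ico (0 : ℝ) T) t)
    (hconv : ConvexOn ℝ (Set.Ico (0 : ℝ) T) h)
    (hpos : ∀ t ∈ Set.Ico (0 : ℝ) T, 0 < h'' t)
    (hsc : ∀ t ∈ Set.Ico (0 : ℝ) T, |h''' t| ≤ 2 * c * (h'' t) ^ ((3 : ℝ) / 2)) :
    (∀ t ∈ Set.Ico (0 : ℝ) T, c * t * Real.sqrt (h'' 0) < 1 →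
      h t ≤ h 0 + h' 0 * t - (1 / c) * Real.sqrt (h'' 0) * t
        - (1 / c ^ 2) * Real.log (1 - c * t * Real.sqrt (h'' 0))) ∧
    h 0 = h 0 + h' 0 * 0 - (1 / c) * Real.sqrt (h'' 0) * 0
        - (1 / c ^ 2) * Real.log (1 - c * 0 * Real.sqrt (h'' 0)) := by
  refine ⟨fun t ht hlt => ?_, by simp⟩
  have hsub : Icc 0 t ⊆ Ico 0 T := Icc_subset_Ico_right ht.2
  have hbound := le_sq_div_of_selfConcordant hc (fun s hs => (hd3 s (hsub hs)).mono hsub)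
    (fun s hs => hpos s (hsub hs)) (fun s hs => hsc s (hsub hs)) hlt
  set a := √(h'' 0) with ha
  have hden : ∀ s ∈ Icc 0 t, 0 < 1 - c * s * a := fun s hs => by
    have : c * s * a ≤ c * t * a := by gcongr; exact hs.2
    linarith
  have hlin : ∀ s, HasDerivAt (fun s => 1 - c * s * a) (-(c * a)) s := fun s => by
    simpa using (((hasDerivAt_id s).const_mul c).mul_const a).const_sub 1
  have hfirst : ∀ s ∈ Icc 0 t, h' s ≤ h' 0 - a / c + a / c * (1 - c * s * a)⁻¹ := by
    refine le_on_Icc_of_hasDerivWithinAt_le (fun s hs => (hd2 s (hsub hs)).mono hsub)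
      (fun s hs => ((((hlin s).inv (hden s hs).ne').const_mul (a / c)).const_add
        (h' 0 - a / c)).hasDerivWithinAt) (fun s hs => (hbound s hs).trans_eq ?_) (by simp)
    have := (hden s hs).ne'
    field_simp
  refine le_on_Icc_of_hasDerivWithinAt_le
    (G := fun s => h 0 + h' 0 * s - 1 / c * a * s - 1 / c ^ 2 * Real.log (1 - c * s * a))
    (fun s hs => (hd1 s (hsub hs)).mono hsub)
    (fun s hs => (((((hasDerivAt_id s).const_mul (h' 0)).const_add (h 0)).sub
      ((hasDerivAt_id s).const_mul (1 / c * a))).sub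
        (((hlin s).log (hden s hs).ne').const_mul (1 / c ^ 2))).hasDerivWithinAt)
    (fun s hs => (hfirst s hs).trans_eq ?_) (by simp) t (right_mem_Icc.2 ht.1)
  have := (hden s hs).ne'
  field_simp
  ring
end

section
/- Let S_1, …, S_m be nonempty closed subsets of ℝ^p, let α_1, …, α_m be nonnegative weights, and let x_n ∈ ℝ^p. For each j choose p_j ∈ S_j with ‖x_n − p_j‖ = dist(x_n, S_j) (a nearest point of S_j to x_n), and set x_{n+1} = Σ_{j=1}^{m} α_j p_j with Σ_j α_j = 1. Then the averaged projection update decreases the objective: Σ_{j=1}^{m} α_j·dist(x_{n+1}, S_j)² ≤ Σ_{j=1}^{m} α_j·dist(x_n, S_j)². -/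
/-- Huygens' identity for the weighted mean of a finite family of points. -/
theorem sum_mul_norm_sub_sq_eq_add_norm_sub_weightedMean_sq {ι E : Type*} [Fintype ι]
    [NormedAddCommGroup E] [InnerProductSpace ℝ E] (w : ι → ℝ) (hw : ∑ i, w i = 1)
    (z : ι → E) (x : E) :
    ∑ i, w i * ‖x - z i‖ ^ 2 =
      ∑ i, w i * ‖(∑ j, w j • z j) - z i‖ ^ 2 + ‖x - ∑ j, w j • z j‖ ^ 2 := by
  set c := ∑ j, w j • z j with hc
  have h_inner : ∑ i, w i * inner ℝ (x - c) (c - z i) = 0 := by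
    simp_rw [← real_inner_smul_right]
    rw [← inner_sum]
    simp [smul_sub, Finset.sum_sub_distrib, ← Finset.sum_smul, hw, ← hc]
  have h_expand (i : ι) : w i * ‖x - z i‖ ^ 2 =
      w i * ‖c - z i‖ ^ 2 + w i * ‖x - c‖ ^ 2 + 2 * (w i * inner ℝ (x - c) (c - z i)) := by
    rw [← sub_add_sub_cancel x c (z i), norm_add_sq_real]
    ring
  simp_rw [h_expand, Finset.sum_add_distrib]
  rw [← Finset.mul_sum, h_inner, ← Finset.sum_mul, hw]
  ring


/-- The averaged projection update decreases the weighted sum of squared distances: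
if `pⱼ` is a nearest point of `Sⱼ` to `xₙ` and `x_{n+1} = Σⱼ αⱼ pⱼ` with convex
weights `αⱼ`, then `Σⱼ αⱼ·dist(x_{n+1},Sⱼ)² ≤ Σⱼ αⱼ·dist(xₙ,Sⱼ)²`. -/
theorem stmt_10 (p m : ℕ) (S : Fin m → Set (EuclideanSpace ℝ (Fin p)))
    (hclosed : ∀ j, IsClosed (S j)) (hne : ∀ j, (S j).Nonempty)
    (α : Fin m → ℝ) (hα : ∀ j, 0 ≤ α j) (hsum : ∑ j, α j = 1)
    (xn : EuclideanSpace ℝ (Fin p))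
    (proj : Fin m → EuclideanSpace ℝ (Fin p))
    (hprojmem : ∀ j, proj j ∈ S j)
    (hprojdist : ∀ j, ‖xn - proj j‖ = Metric.infDist xn (S j))
    (xnew : EuclideanSpace ℝ (Fin p)) (hxnew : xnew = ∑ j, α j • proj j) :
    ∑ j, α j * (Metric.infDist xnew (S j)) ^ 2 ≤
      ∑ j, α j * (Metric.infDist xn (S j)) ^ 2 := by
  calc
    ∑ j, α j * (Metric.infDist xnew (S j)) ^ 2 ≤ ∑ j, α j * ‖xnew - proj j‖ ^ 2 := by
      gcongr with j
      · exact hα j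
      · exact Metric.infDist_nonneg
      · rw [← dist_eq_norm]
        exact Metric.infDist_le_dist_of_mem (hprojmem j)
    _ ≤ ∑ j, α j * ‖xn - proj j‖ ^ 2 := by
      rw [sum_mul_norm_sub_sq_eq_add_norm_sub_weightedMean_sq α hsum proj xn, ← hxnew]
      exact le_add_of_nonneg_right (sq_nonneg _)
    _ = ∑ j, α j * (Metric.infDist xn (S j)) ^ 2 := by simp_rw [hprojdist]
end

section
/- Let f : ℝ^p → ℝ, let S be a nonempty closed subset of ℝ^p, and let ρ > 0, ε > 0. Given a current iterate x_n, choose p ∈ S with ‖x_n − p‖ = dist(x_n, S), set the weight w_n = ρ / √(‖x_n − p‖² + ε), and let x_{n+1} minimize the surrogate g(x | x_n) = f(x) + (w_n/2)·‖x − p‖² over ℝ^p. Then the proximal distance update satisfies the descent property f(x_{n+1}) + ρ·√(dist(x_{n+1}, S)² + ε) ≤ f(x_n) + ρ·√(dist(x_n, S)² + ε). -/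
/-- The square root lies below its tangent line at any positive point. -/
theorem Real.sqrt_le_sqrt_add_div {a b : ℝ} (ha : 0 < a) (hb : 0 ≤ b) :
    Real.sqrt b ≤ Real.sqrt a + (b - a) / (2 * Real.sqrt a) := by
  have hs : 0 < Real.sqrt a := Real.sqrt_pos.mpr ha
  rw [← sub_le_iff_le_add', le_div_iff₀ (by positivity)]
  nlinarith [sq_nonneg (Real.sqrt b - Real.sqrt a), Real.sq_sqrt ha.le, Real.sq_sqrt hb]

/-- Descent property of the proximal distance update: if `q ∈ S` is a nearest
point of `S` to `xₙ`, `wₙ = ρ/√(‖xₙ - q‖² + ε)`, and `x_{n+1}` minimizes the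
surrogate `f(x) + (wₙ/2)·‖x - q‖²`, then
`f(x_{n+1}) + ρ·√(dist(x_{n+1},S)² + ε) ≤ f(xₙ) + ρ·√(dist(xₙ,S)² + ε)`. -/
theorem stmt_15 (d : ℕ) (f : EuclideanSpace ℝ (Fin d) → ℝ)
    (S : Set (EuclideanSpace ℝ (Fin d))) (hSclosed : IsClosed S) (hSne : S.Nonempty)
    (ρ ε : ℝ) (hρ : 0 < ρ) (hε : 0 < ε)
    (xn q : EuclideanSpace ℝ (Fin d)) (hq : q ∈ S)
    (hqdist : ‖xn - q‖ = Metric.infDist xn S)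
    (w : ℝ) (hw : w = ρ / Real.sqrt (‖xn - q‖ ^ 2 + ε))
    (xnew : EuclideanSpace ℝ (Fin d))
    (hmin : ∀ x, f xnew + (w / 2) * ‖xnew - q‖ ^ 2 ≤ f x + (w / 2) * ‖x - q‖ ^ 2) :
    f xnew + ρ * Real.sqrt ((Metric.infDist xnew S) ^ 2 + ε) ≤
      f xn + ρ * Real.sqrt ((Metric.infDist xn S) ^ 2 + ε) := by
  rw [← hqdist]
  have hdist : Metric.infDist xnew S ≤ ‖xnew - q‖ := by
    simpa [dist_eq_norm] using Metric.infDist_le_dist_of_mem (x := xnew) hq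
  have hsqrt : Real.sqrt ((Metric.infDist xnew S) ^ 2 + ε) ≤
      Real.sqrt (‖xnew - q‖ ^ 2 + ε) := by
    have := Metric.infDist_nonneg (x := xnew) (s := S)
    gcongr
  have htangent := Real.sqrt_le_sqrt_add_div (a := ‖xn - q‖ ^ 2 + ε)
    (b := ‖xnew - q‖ ^ 2 + ε) (by positivity) (by positivity)
  have hmajor := mul_le_mul_of_nonneg_left (hsqrt.trans htangent) hρ.le
  have hweight : ρ * ((‖xnew - q‖ ^ 2 + ε - (‖xn - q‖ ^ 2 + ε)) /
      (2 * Real.sqrt (‖xn - q‖ ^ 2 + ε))) =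
      w / 2 * ‖xnew - q‖ ^ 2 - w / 2 * ‖xn - q‖ ^ 2 := by
    rw [hw]
    ring
  rw [mul_add, hweight] at hmajor
  linarith [hmin xn]
end
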